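/- arXiv:2405.18298 — 2 statements merged into one kernel-verified Lean document; each statement's English description precedes it below -/
import Mathlib

section
/- For every \mathbb{X}-compatible staged tree T with staging \theta there exists a minimal order-compatible DAG G_T such that \mathcal{M}_{T,\theta} \subseteq \mathcal{M}_{G_T}, and G_T is minimal in the sense that its edge set is contained in the edge set of every order-compatible DAG G satisfying \mathcal{M}_{T,\theta} \subseteq \mathcal{M}_G. -/
open Finset

section StagedTrees

variable {p : ℕ}

/-- A strictly positive probability distribution on the finite product space `∀ i, X i`. -/
def StrictlyPositiveDist {X : Fin p → Type*} [∀ i, Fintype (X i)]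
    (P : (∀ i, X i) → ℝ) : Prop :=
  (∀ x, 0 < P x) ∧ ∑ x, P x = 1

/-- The conditional probability `P(X i = a ∣ X_[i-1] = x_[i-1])`, where the prefix
`x_[i-1]` consists of the coordinates of `x` of index `< i`. -/
noncomputable def condProb {X : Fin p → Type*} [∀ i, Fintype (X i)] [∀ i, DecidableEq (X i)]
    (P : (∀ i, X i) → ℝ) (i : Fin p) (a : X i) (x : ∀ j, X j) : ℝ :=
  (∑ y ∈ univ.filter (fun y : ∀ j, X j => y i = a ∧ ∀ j, j < i → y j = x j), P y) /
    (∑ y ∈ univ.filter (fun y : ∀ j, X j => ∀ j, j < i → y j = x j), P y)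

/-- The conditional probability `P(X i = a ∣ X_A = x_A)` for a set `A` of coordinates. -/
noncomputable def condProbOn {X : Fin p → Type*} [∀ i, Fintype (X i)] [∀ i, DecidableEq (X i)]
    (P : (∀ i, X i) → ℝ) (A : Finset (Fin p)) (i : Fin p) (a : X i) (x : ∀ j, X j) : ℝ :=
  (∑ y ∈ univ.filter (fun y : ∀ j, X j => y i = a ∧ ∀ j ∈ A, y j = x j), P y) /
    (∑ y ∈ univ.filter (fun y : ∀ j, X j => ∀ j ∈ A, y j = x j), P y)

/-- A staging of the `X`-compatible staged tree: for each level `i`, a partition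
(equivalence relation) of the prefixes `x_[i-1]`, encoded as an equivalence relation on
full configurations that identifies configurations with the same prefix of length `i`
(coordinates of index `< i`). Vertices in the same class are in the same stage. -/
structure Staging (X : Fin p → Type*) where
  rel : Fin p → (∀ j, X j) → (∀ j, X j) → Prop
  equiv : ∀ i, Equivalence (rel i)
  prefix_mem : ∀ i x y, (∀ j, j < i → x j = y j) → rel i x y

/-- Membership in the staged tree model `𝓜_{T,θ}`: `P` is a strictly positive distribution and
prefixes in the same stage give equal conditional distributions for the next variable. -/
def MemStagedTreeModel {X : Fin p → Type*} [∀ i, Fintype (X i)] [∀ i, DecidableEq (X i)]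
    (σ : Staging X) (P : (∀ i, X i) → ℝ) : Prop :=
  StrictlyPositiveDist P ∧
    ∀ i x x', σ.rel i x x' → ∀ a : X i, condProb P i a x = condProb P i a x'

/-- A DAG on `{1,…,p}` compatible with the variable ordering, encoded by its parent sets:
every parent of `i` precedes `i`. -/
def OrderCompat (par : Fin p → Finset (Fin p)) : Prop :=
  ∀ i, ∀ j ∈ par i, j < i

/-- `P` is (strictly positive and) Markov to the DAG with parent sets `par`:
`P x = ∏ k P(x k ∣ x_{par k})`. -/
def MarkovTo {X : Fin p → Type*} [∀ i, Fintype (X i)] [∀ i, DecidableEq (X i)]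
    (par : Fin p → Finset (Fin p)) (P : (∀ i, X i) → ℝ) : Prop :=
  StrictlyPositiveDist P ∧ ∀ x, P x = ∏ i, condProbOn P (par i) i (x i) x

/-- `par` is the minimal DAG `G_T` of the staged tree with staging `σ`: it is order-compatible,
`𝓜_{T,θ} ⊆ 𝓜_{G_T}`, and its edge set is contained in the edge set of every order-compatible
DAG `G` with `𝓜_{T,θ} ⊆ 𝓜_G`. -/
def IsMinimalDAG {X : Fin p → Type*} [∀ i, Fintype (X i)] [∀ i, DecidableEq (X i)]
    (σ : Staging X) (par : Fin p → Finset (Fin p)) : Prop :=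
  OrderCompat par ∧ (∀ P, MemStagedTreeModel σ P → MarkovTo par P) ∧
    ∀ par', OrderCompat par' → (∀ P, MemStagedTreeModel σ P → MarkovTo par' P) →
      ∀ i, par i ⊆ par' i

/-- The number of stages at level `i` of a staging: the number of equivalence classes. -/
noncomputable def numStages {X : Fin p → Type*} (σ : Staging X) (i : Fin p) : ℕ :=
  Set.ncard {S : Set (∀ j, X j) | ∃ x, S = {y | σ.rel i x y}}

/-- In the classification setting the variables are `(C, X₁, …, X_q)` with the class `C` at
index `0`. A Bayesian network classifier: an order-compatible DAG in which `C` has no parents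
and `C` is a parent of every feature. -/
def IsBNC {q : ℕ} (par : Fin (q + 1) → Finset (Fin (q + 1))) : Prop :=
  OrderCompat par ∧ par 0 = ∅ ∧ ∀ i : Fin (q + 1), i ≠ 0 → (0 : Fin (q + 1)) ∈ par i

/-- A `k`-DB BNC: a BNC in which every feature has at most `k` feature parents. -/
def IsKDB {q : ℕ} (par : Fin (q + 1) → Finset (Fin (q + 1))) (k : ℕ) : Prop :=
  IsBNC par ∧ ∀ i, ((par i).erase 0).card ≤ k

end StagedTrees

section Aux

variable {p : ℕ} {X : Fin p → Type*} [∀ i, Fintype (X i)] [∀ i, DecidableEq (X i)]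

/-- Mass of the cylinder of configurations agreeing with `x` on the first `k` coordinates. -/
noncomputable def cylMass (P : (∀ i, X i) → ℝ) (k : ℕ) (x : ∀ j, X j) : ℝ :=
  ∑ y ∈ univ.filter (fun y : ∀ j, X j => ∀ j : Fin p, j.val < k → y j = x j), P y

lemma cyl_succ_iff (k : Fin p) (a : X k) (x y : ∀ j, X j) :
    (∀ j : Fin p, j.val < k.val + 1 → y j = Function.update x k a j) ↔
      (y k = a ∧ ∀ j : Fin p, j < k → y j = x j) := by
  constructor
  · intro h
    refine ⟨by simpa using h k (by omega), fun j hj => ?_⟩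
    have := h j (by have := Fin.lt_def.1 hj; omega)
    rwa [Function.update_of_ne hj.ne] at this
  · rintro ⟨h1, h2⟩ j hj
    by_cases hjk : j = k
    · subst hjk; simpa using h1
    · rw [Function.update_of_ne hjk]
      apply h2
      have : j.val ≠ k.val := fun h => hjk (Fin.ext h)
      exact Fin.lt_def.2 (by omega)

lemma condProb_eq (P : (∀ i, X i) → ℝ) (i : Fin p) (a : X i) (x : ∀ j, X j) :
    condProb P i a x = cylMass P (i.val + 1) (Function.update x i a) / cylMass P i.val x := by
  unfold condProb cylMass
  congr 1
  apply Finset.sum_congr _ (fun _ _ => rfl)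
  ext y
  simp only [mem_filter, mem_univ, true_and]
  exact (cyl_succ_iff i a x y).symm

lemma cylMass_split (P : (∀ i, X i) → ℝ) (k : Fin p) (x : ∀ j, X j) :
    cylMass P k.val x = ∑ b : X k, cylMass P (k.val + 1) (Function.update x k b) := by
  unfold cylMass
  rw [← Finset.sum_fiberwise _ (fun y : ∀ j, X j => y k)]
  refine Finset.sum_congr rfl fun b _ => ?_
  apply Finset.sum_congr _ (fun _ _ => rfl)
  ext y
  simp only [mem_filter, mem_univ, true_and]
  rw [cyl_succ_iff, and_comm]
  rfl

lemma cylMass_top (P : (∀ i, X i) → ℝ) (x : ∀ j, X j) : cylMass P p x = P x := by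
  unfold cylMass
  have : (univ.filter (fun y : ∀ j, X j => ∀ j : Fin p, j.val < p → y j = x j)) = {x} := by
    ext y
    simp only [mem_filter, mem_univ, true_and, mem_singleton]
    exact ⟨fun h => funext fun j => h j j.2, fun h j _ => by rw [h]⟩
  rw [this, sum_singleton]

lemma cylMass_zero (P : (∀ i, X i) → ℝ) (x : ∀ j, X j) : cylMass P 0 x = ∑ y, P y := by
  unfold cylMass
  simp

lemma cylMass_pos (P : (∀ i, X i) → ℝ) (hP : ∀ x, 0 < P x) (k : ℕ) (x : ∀ j, X j) :
    0 < cylMass P k x := by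
  unfold cylMass
  exact Finset.sum_pos (fun y _ => hP y) ⟨x, by simp⟩

/-- Chain rule. -/
lemma chain_rule (P : (∀ i, X i) → ℝ) (hP : StrictlyPositiveDist P) (x : ∀ j, X j) :
    P x = ∏ i, condProb P i (x i) x := by
  have h1 : ∀ i : Fin p, condProb P i (x i) x
      = cylMass P (i.val + 1) x / cylMass P i.val x := by
    intro i
    rw [condProb_eq, Function.update_eq_self]
  simp_rw [h1]
  rw [Fin.prod_univ_eq_prod_range (fun k => cylMass P (k + 1) x / cylMass P k x) p]
  have h2 : ∀ n : ℕ, ∏ k ∈ range n, cylMass P (k + 1) x / cylMass P k x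
      = cylMass P n x / cylMass P 0 x := by
    intro n
    induction n with
    | zero => simp [(cylMass_pos P hP.1 0 x).ne']
    | succ n ih =>
      rw [prod_range_succ, ih]
      have := (cylMass_pos P hP.1 0 x).ne'
      have := (cylMass_pos P hP.1 n x).ne'
      field_simp
  rw [h2, cylMass_top, cylMass_zero, hP.2, div_one]

/-- Cylinder masses of a product of kernels. -/
lemma cylMass_kernel (f : Fin p → (∀ j, X j) → ℝ)
    (hdep : ∀ k x y, (∀ j, j ≤ k → x j = y j) → f k x = f k y)
    (hsum : ∀ k x, ∑ b : X k, f k (Function.update x k b) = 1)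
    (k : ℕ) (hk : k ≤ p) (x : ∀ j, X j) :
    cylMass (fun x => ∏ m, f m x) k x
      = ∏ m ∈ univ.filter (fun m : Fin p => m.val < k), f m x := by
  induction hk using Nat.decreasingInduction generalizing x with
  | self =>
    rw [cylMass_top]
    congr 1
    ext m
    simp
  | of_succ k hk ih =>
    have hs := cylMass_split (fun x => ∏ m, f m x) ⟨k, hk⟩ x
    rw [show k = (⟨k, hk⟩ : Fin p).val from rfl, hs]
    have hset : (univ.filter (fun m : Fin p => m.val < k + 1))
        = insert (⟨k, hk⟩ : Fin p) (univ.filter (fun m : Fin p => m.val < k)) := by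
      ext m
      simp only [mem_filter, mem_univ, true_and, mem_insert, Fin.ext_iff]
      omega
    have : ∀ b : X ⟨k, hk⟩, cylMass (fun x => ∏ m, f m x) (k + 1)
        (Function.update x (⟨k, hk⟩ : Fin p) b)
        = f ⟨k, hk⟩ (Function.update x (⟨k, hk⟩ : Fin p) b) *
          ∏ m ∈ univ.filter (fun m : Fin p => m.val < k), f m x := by
      intro b
      rw [ih, hset, prod_insert (by simp)]
      congr 1
      refine prod_congr rfl fun m hm => ?_
      simp only [mem_filter, mem_univ, true_and] at hm
      apply hdep
      intro j hj
      rw [Function.update_of_ne]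
      rintro rfl
      have := Fin.le_def.1 hj
      simp at this
      omega
    simp only [this]
    rw [← Finset.sum_mul, hsum, one_mul]

lemma kernel_condProb (f : Fin p → (∀ j, X j) → ℝ)
    (hpos : ∀ k x, 0 < f k x)
    (hdep : ∀ k x y, (∀ j, j ≤ k → x j = y j) → f k x = f k y)
    (hsum : ∀ k x, ∑ b : X k, f k (Function.update x k b) = 1)
    (k : Fin p) (a : X k) (x : ∀ j, X j) :
    condProb (fun x => ∏ m, f m x) k a x = f k (Function.update x k a) := by
  rw [condProb_eq, cylMass_kernel f hdep hsum _ (by omega),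
    cylMass_kernel f hdep hsum _ (by omega)]
  have hset : (univ.filter (fun m : Fin p => m.val < k.val + 1))
      = insert k (univ.filter (fun m : Fin p => m.val < k.val)) := by
    ext m
    simp only [mem_filter, mem_univ, true_and, mem_insert, Fin.ext_iff]
    omega
  rw [hset, prod_insert (by simp)]
  have : ∏ m ∈ univ.filter (fun m : Fin p => m.val < k.val), f m (Function.update x k a)
      = ∏ m ∈ univ.filter (fun m : Fin p => m.val < k.val), f m x := by
    refine prod_congr rfl fun m hm => ?_
    simp only [mem_filter, mem_univ, true_and] at hm
    apply hdep
    intro j hj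
    rw [Function.update_of_ne]
    rintro rfl
    have := Fin.le_def.1 hj
    omega
  rw [this]
  have h0 : ∏ m ∈ univ.filter (fun m : Fin p => m.val < k.val), f m x ≠ 0 :=
    (prod_pos fun m _ => hpos m x).ne'
  field_simp

lemma condProbOn_congr (P : (∀ i, X i) → ℝ) (A : Finset (Fin p)) (i : Fin p) (a : X i)
    (x y : ∀ j, X j) (h : ∀ j ∈ A, x j = y j) :
    condProbOn P A i a x = condProbOn P A i a y := by
  have key : ∀ z : ∀ j, X j, (∀ j ∈ A, z j = x j) ↔ (∀ j ∈ A, z j = y j) := fun z =>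
    ⟨fun hz j hj => (hz j hj).trans (h j hj), fun hz j hj => (hz j hj).trans (h j hj).symm⟩
  unfold condProbOn
  simp only [key]

lemma condProbOn_sum (P : (∀ i, X i) → ℝ) (hP : ∀ x, 0 < P x) (A : Finset (Fin p)) (i : Fin p)
    (x : ∀ j, X j) : ∑ b : X i, condProbOn P A i b x = 1 := by
  unfold condProbOn
  rw [← Finset.sum_div]
  have hD : 0 < ∑ y ∈ univ.filter (fun y : ∀ j, X j => ∀ j ∈ A, y j = x j), P y :=
    Finset.sum_pos (fun y _ => hP y) ⟨x, by simp⟩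
  rw [div_eq_one_iff_eq hD.ne', ← Finset.sum_fiberwise _ (fun y : ∀ j, X j => y i)]
  refine Finset.sum_congr rfl fun b _ => ?_
  apply Finset.sum_congr _ (fun _ _ => rfl)
  ext y
  simp only [mem_filter, mem_univ, true_and]
  rw [and_comm]

lemma condProbOn_pos (P : (∀ i, X i) → ℝ) (hP : ∀ x, 0 < P x) (A : Finset (Fin p)) (i : Fin p)
    (x : ∀ j, X j) : 0 < condProbOn P A i (x i) x := by
  unfold condProbOn
  exact div_pos (Finset.sum_pos (fun y _ => hP y) ⟨x, by simp⟩)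
    (Finset.sum_pos (fun y _ => hP y) ⟨x, by simp⟩)

/-- For Markov distributions the parents determine the conditional distributions. -/
lemma markov_condProb (par : Fin p → Finset (Fin p)) (hpar : OrderCompat par)
    (P : (∀ i, X i) → ℝ) (hP : MarkovTo par P) (i : Fin p) (a : X i) (x : ∀ j, X j) :
    condProb P i a x = condProbOn P (par i) i a x := by
  have hself : ∀ k, k ∉ par k := fun k hk => lt_irrefl _ (hpar k k hk)
  have hupd : ∀ (k : Fin p) (x : ∀ j, X j) (b c : X k),
      condProbOn P (par k) k c (Function.update x k b) = condProbOn P (par k) k c x := by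
    intro k x b c
    apply condProbOn_congr
    intro j hj
    rw [Function.update_of_ne]
    rintro rfl
    exact hself _ hj
  have h := kernel_condProb (fun k x => condProbOn P (par k) k (x k) x)
    (fun k x => condProbOn_pos P hP.1.1 _ _ _)
    (fun k x y hxy => by
      rw [hxy k le_rfl]
      exact condProbOn_congr _ _ _ _ _ _ fun j hj => hxy j (hpar k j hj).le)
    (fun k x => by
      simp only [Function.update_self, hupd]
      exact condProbOn_sum P hP.1.1 _ _ _) i a x
  have hPeq : (fun x => ∏ m, condProbOn P (par m) m (x m) x) = P :=
    funext fun x => (hP.2 x).symm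
  simp only [Function.update_self, hupd, hPeq] at h
  exact h

/-- If the conditional distribution is constant on an `A`-cylinder, it is the one given `A`. -/
lemma condProbOn_eq_of_const (P : (∀ i, X i) → ℝ) (hP : ∀ x, 0 < P x) (A : Finset (Fin p))
    (i : Fin p) (hA : ∀ j ∈ A, j < i) (a : X i) (x : ∀ j, X j)
    (hc : ∀ y : ∀ j, X j, (∀ j ∈ A, y j = x j) → condProb P i a y = condProb P i a x) :
    condProbOn P A i a x = condProb P i a x := by
  classical
  set c := condProb P i a x with hcdef
  have hD : 0 < ∑ y ∈ univ.filter (fun y : ∀ j, X j => ∀ j ∈ A, y j = x j), P y :=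
    Finset.sum_pos (fun y _ => hP y) ⟨x, by simp⟩
  unfold condProbOn
  rw [div_eq_iff hD.ne', ← sub_eq_zero, Finset.mul_sum]
  have h1 : ∑ y ∈ univ.filter (fun y : ∀ j, X j => y i = a ∧ ∀ j ∈ A, y j = x j), P y
      = ∑ y ∈ univ.filter (fun y : ∀ j, X j => ∀ j ∈ A, y j = x j),
          if y i = a then P y else 0 := by
    rw [← Finset.sum_filter, Finset.filter_filter]
    apply Finset.sum_congr _ (fun _ _ => rfl)
    ext y
    simp only [mem_filter, mem_univ, true_and]
    rw [and_comm]
  rw [h1, ← Finset.sum_sub_distrib,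
    ← Finset.sum_fiberwise _ (fun y (j : {j : Fin p // j < i}) => y j.1)]
  apply Finset.sum_eq_zero
  intro g _
  by_cases hg : ∃ z : ∀ j, X j, (∀ j ∈ A, z j = x j) ∧ (fun j : {j : Fin p // j < i} => z j.1) = g
  · obtain ⟨z, hz, rfl⟩ := hg
    have hset : ((univ.filter (fun y : ∀ j, X j => ∀ j ∈ A, y j = x j)).filter
        (fun y => (fun j : {j : Fin p // j < i} => y j.1) = fun j => z j.1))
        = univ.filter (fun y : ∀ j, X j => ∀ j, j < i → y j = z j) := by
      ext y
      simp only [mem_filter, mem_univ, true_and]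
      constructor
      · rintro ⟨_, h⟩ j hj
        exact congrFun h ⟨j, hj⟩
      · intro h
        exact ⟨fun j hj => (h j (hA j hj)).trans (hz j hj), funext fun j => h j.1 j.2⟩
    rw [hset, Finset.sum_sub_distrib, ← Finset.mul_sum, ← Finset.sum_filter, Finset.filter_filter,
      ← hc z hz]
    have hDz : 0 < ∑ y ∈ univ.filter (fun y : ∀ j, X j => ∀ j, j < i → y j = z j), P y :=
      Finset.sum_pos (fun y _ => hP y) ⟨z, by simp⟩
    unfold condProb
    rw [div_mul_cancel₀ _ hDz.ne', sub_eq_zero]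
    apply Finset.sum_congr _ (fun _ _ => rfl)
    ext y
    simp only [mem_filter, mem_univ, true_and]
    rw [and_comm]
  · apply Finset.sum_eq_zero
    intro y hy
    simp only [mem_filter, mem_univ, true_and] at hy
    exact absurd ⟨y, hy.1, hy.2⟩ hg

/-- Changing coordinates one at a time. -/
lemma rel_of_agree {X : Fin p → Type*} (σ : Staging X) (i : Fin p) (A : Finset (Fin p))
    (hA : ∀ j, j ∉ A → ∀ x b, σ.rel i x (Function.update x j b))
    (x y : ∀ j, X j) (h : ∀ j ∈ A, x j = y j) : σ.rel i x y := by
  have key : ∀ S : Finset (Fin p), Disjoint S A → σ.rel i x (S.piecewise y x) := by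
    intro S
    induction S using Finset.induction_on with
    | empty => intro _; rw [Finset.piecewise_empty]; exact (σ.equiv i).refl x
    | insert j S hj ih =>
      intro hd
      rw [Finset.disjoint_insert_left] at hd
      rw [Finset.piecewise_insert]
      exact (σ.equiv i).trans (ih hd.2) (hA j hd.1 _ _)
  have := key Aᶜ disjoint_compl_left
  have he : (Aᶜ).piecewise y x = y := by
    ext j
    by_cases hj : j ∈ A
    · simp [hj, h j hj]
    · simp [hj]
  rwa [he] at this

/-- Two distinct stages are separated by some distribution of the model. -/
lemma exists_separating (hcard : ∀ i, 2 ≤ Fintype.card (X i)) (σ : Staging X) (i : Fin p)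
    (x x' : ∀ j, X j) (hx : ¬ σ.rel i x x') :
    ∃ P, MemStagedTreeModel σ P ∧ ∃ a : X i, condProb P i a x ≠ condProb P i a x' := by
  classical
  let w : ∀ k : Fin p, (∀ j, X j) → X k → ℝ := fun k z b =>
    if k = i ∧ σ.rel i x z ∧ b = x k then 2 else 1
  have hw : ∀ k z b, 0 < w k z b := by
    intro k z b
    simp only [w]
    split_ifs <;> norm_num
  have hwrel : ∀ k z z', σ.rel k z z' → w k z = w k z' := by
    intro k z z' h
    funext b
    simp only [w]
    by_cases hk : k = i
    · subst hk
      have : σ.rel k x z ↔ σ.rel k x z' :=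
        ⟨fun h' => (σ.equiv k).trans h' h, fun h' => (σ.equiv k).trans h' ((σ.equiv k).symm h)⟩
      simp [this]
    · simp [hk]
  have hW : ∀ k z, 0 < ∑ b, w k z b := fun k z => Finset.sum_pos (fun b _ => hw k z b) ⟨x k, mem_univ _⟩
  let f : Fin p → (∀ j, X j) → ℝ := fun k z => w k z (z k) / ∑ b, w k z b
  have hupd : ∀ (k : Fin p) (z : ∀ j, X j) (b : X k), w k (Function.update z k b) = w k z := by
    intro k z b
    apply hwrel
    apply σ.prefix_mem
    intro j hj
    rw [Function.update_of_ne hj.ne]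
  have hpos : ∀ k z, 0 < f k z := fun k z => div_pos (hw _ _ _) (hW _ _)
  have hdep : ∀ k z z', (∀ j, j ≤ k → z j = z' j) → f k z = f k z' := by
    intro k z z' h
    simp only [f]
    rw [hwrel k z z' (σ.prefix_mem k z z' fun j hj => h j hj.le), h k le_rfl]
  have hsum : ∀ k z, ∑ b : X k, f k (Function.update z k b) = 1 := by
    intro k z
    simp only [f, hupd, Function.update_self]
    rw [← Finset.sum_div, div_self (hW k z).ne']
  have hcp : ∀ k a z, condProb (fun x => ∏ m, f m x) k a z = w k z a / ∑ b, w k z b := by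
    intro k a z
    rw [kernel_condProb f hpos hdep hsum]
    simp only [f, hupd, Function.update_self]
  refine ⟨fun x => ∏ m, f m x, ⟨⟨fun z => prod_pos fun m _ => hpos m z, ?_⟩, ?_⟩, x i, ?_⟩
  · rw [← cylMass_zero _ x, cylMass_kernel f hdep hsum 0 (Nat.zero_le _)]
    simp
  · intro k z z' h a
    rw [hcp, hcp, hwrel k z z' h]
  · rw [hcp, hcp]
    have hxx : σ.rel i x x := (σ.equiv i).refl x
    have e1 : ∑ b, w i x b = (Fintype.card (X i) : ℝ) + 1 := by
      have : ∀ b, w i x b = 1 + if b = x i then 1 else 0 := by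
        intro b
        simp only [w, hxx]
        by_cases hb : b = x i <;> simp [hb]
        norm_num
      simp only [this, Finset.sum_add_distrib]
      simp
    have e2 : ∑ b, w i x' b = (Fintype.card (X i) : ℝ) := by
      simp [w, hx]
    have e3 : w i x (x i) = 2 := by simp [w, hxx]
    have e4 : w i x' (x i) = 1 := by simp [w, hx]
    rw [e1, e2, e3, e4]
    have hc : (2 : ℝ) ≤ Fintype.card (X i) := by exact_mod_cast hcard i
    intro h
    rw [div_eq_div_iff (by positivity) (by positivity)] at h
    linarith

end Aux

/-- every `X`-compatible staged tree with staging `θ` admits a minimal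
order-compatible DAG `G_T`: `𝓜_{T,θ} ⊆ 𝓜_{G_T}` and the edge set of `G_T` is contained in the
edge set of every order-compatible DAG `G` with `𝓜_{T,θ} ⊆ 𝓜_G`. -/
theorem exists_minimal_dag {p : ℕ} (X : Fin p → Type*)
    [∀ i, Fintype (X i)] [∀ i, DecidableEq (X i)]
    (hcard : ∀ i, 2 ≤ Fintype.card (X i)) (σ : Staging X) :
    ∃ par : Fin p → Finset (Fin p), IsMinimalDAG σ par := by
  classical
  let par : Fin p → Finset (Fin p) := fun i =>
    univ.filter (fun j => j < i ∧ ∃ x b, ¬ σ.rel i x (Function.update x j b))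
  have hoc : OrderCompat par := by
    intro i j hj
    simp only [par, mem_filter] at hj
    exact hj.2.1
  refine ⟨par, hoc, ?_, ?_⟩
  · intro P hP
    refine ⟨hP.1, fun x => ?_⟩
    rw [chain_rule P hP.1 x]
    refine prod_congr rfl fun i _ => ?_
    symm
    apply condProbOn_eq_of_const P hP.1.1 _ _ (hoc i)
    intro y hy
    apply hP.2
    refine rel_of_agree σ i (par i) ?_ y x hy
    intro j hj z b
    by_cases hji : j < i
    · by_contra hn
      exact hj (by simp only [par, mem_filter, mem_univ, true_and]; exact ⟨hji, z, b, hn⟩)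
    · apply σ.prefix_mem
      intro l hl
      rw [Function.update_of_ne]
      rintro rfl
      exact hji hl
  · intro par' hoc' hM i j hj
    simp only [par, mem_filter, mem_univ, true_and] at hj
    obtain ⟨hji, x, b, hn⟩ := hj
    by_contra hjp
    obtain ⟨P, hP, a, ha⟩ := exists_separating hcard σ i _ _ hn
    apply ha
    rw [markov_condProb par' hoc' P (hM P hP), markov_condProb par' hoc' P (hM P hP)]
    apply condProbOn_congr
    intro l hl
    rw [Function.update_of_ne]
    rintro rfl
    exact hjp hl
end

section
/- Naive staged tree classifiers can represent the parity (XOR) decision rule: for a binary class C and two binary features X_1, X_2, there exists a naive staged tree classifier (a staging of the (C, X_1, X_2)-compatible staged tree in which each of the level-1 and level-2 vertex sets is partitioned into exactly 2 stages) and a strictly positive distribution P in its model such that for every (x_1, x_2) \in \{0,1\}^2 the unique maximizer of c \mapsto P(C = c, X_1 = x_1, X_2 = x_2) is c = x_1 \oplus x_2. -/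
open Finset

/-- The stage label of a prefix. -/
def xorLabel (i : Fin (2 + 1)) (x : Fin (2 + 1) → Bool) : Bool :=
  if i = 0 then false else if i = 1 then x 0 else xor (x 0) (x 1)

/-- Weights (out of sixteen). -/
def xorWeight (x : Fin (2 + 1) → Bool) : ℕ :=
  if x 2 = xor (x 0) (x 1) then 3 else 1

/-- The staging by labels. -/
def xorStaging : Staging (fun _ : Fin (2 + 1) => Bool) where
  rel i x y := xorLabel i x = xorLabel i y
  equiv i := ⟨fun _ => rfl, fun h => h.symm, fun h k => h.trans k⟩
  prefix_mem i x y h := by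
    fin_cases i
    · rfl
    · simpa [xorLabel] using h 0 (by decide)
    · have h0 := h 0 (by decide)
      have h1 := h 1 (by decide)
      simp only [xorLabel, h0, h1]

lemma xorLabel_surj : ∀ i : Fin (2 + 1), i ≠ 0 → ∀ b, ∃ x, xorLabel i x = b := by
  decide

lemma xorStaging_numStages (i : Fin (2 + 1)) (hi : i ≠ 0) : numStages xorStaging i = 2 := by
  obtain ⟨t, ht⟩ := xorLabel_surj i hi true
  obtain ⟨f, hf⟩ := xorLabel_surj i hi false
  have : {S : Set (Fin (2 + 1) → Bool) | ∃ x, S = {y | xorStaging.rel i x y}} =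
      {{y | true = xorLabel i y}, {y | false = xorLabel i y}} := by
    ext S
    simp only [xorStaging, Set.mem_setOf_eq, Set.mem_insert_iff, Set.mem_singleton_iff]
    constructor
    · rintro ⟨x, rfl⟩
      cases xorLabel i x <;> simp
    · rintro (rfl | rfl)
      · exact ⟨t, by rw [ht]⟩
      · exact ⟨f, by rw [hf]⟩
  unfold numStages
  rw [this]
  apply Set.ncard_pair
  intro h
  have h' : t ∈ {y | false = xorLabel i y} := h ▸ (show true = xorLabel i t from ht.symm)
  rw [Set.mem_setOf_eq, ht] at h'
  cases h'

set_option maxRecDepth 100000 in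
lemma xorNum : ∀ (i : Fin (2 + 1)) (x x' : Fin (2 + 1) → Bool), xorLabel i x = xorLabel i x' →
    ∀ a : Bool,
    ∑ y ∈ univ.filter (fun y : Fin (2 + 1) → Bool => y i = a ∧ ∀ j, j < i → y j = x j),
      xorWeight y =
    ∑ y ∈ univ.filter (fun y : Fin (2 + 1) → Bool => y i = a ∧ ∀ j, j < i → y j = x' j),
      xorWeight y := by
  decide +kernel

set_option maxRecDepth 100000 in
lemma xorDen : ∀ (i : Fin (2 + 1)) (x x' : Fin (2 + 1) → Bool), xorLabel i x = xorLabel i x' →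
    ∑ y ∈ univ.filter (fun y : Fin (2 + 1) → Bool => ∀ j, j < i → y j = x j), xorWeight y =
    ∑ y ∈ univ.filter (fun y : Fin (2 + 1) → Bool => ∀ j, j < i → y j = x' j), xorWeight y := by
  decide +kernel

lemma xorTotal : ∑ y : Fin (2 + 1) → Bool, xorWeight y = 16 := by
  decide +kernel

lemma xorWeight_pos (x : Fin (2 + 1) → Bool) : 0 < xorWeight x := by
  unfold xorWeight; split <;> norm_num

lemma xorWeight_lt : ∀ x1 x2 c : Bool, c ≠ xor x1 x2 →
    xorWeight ![c, x1, x2] < xorWeight ![xor x1 x2, x1, x2] := by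
  decide

/-- naive staged tree classifiers can represent the XOR rule: for a binary class
`C` (index `0`) and binary features `X₁, X₂`, there is a staging of the `(C,X₁,X₂)`-compatible
staged tree with exactly `2 = |ℂ|` stages at each of levels `1` and `2`, and a strictly positive
distribution `P` in its model such that for every `(x₁,x₂)` the unique maximizer of
`c ↦ P(c,x₁,x₂)` is `c = x₁ ⊕ x₂`. -/
theorem naive_staged_tree_can_represent_xor :
    ∃ σ : Staging (fun _ : Fin (2 + 1) => Bool),
      (∀ i : Fin (2 + 1), i ≠ 0 → numStages σ i = 2) ∧
      ∃ P : (∀ _ : Fin (2 + 1), Bool) → ℝ, MemStagedTreeModel σ P ∧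
        ∀ x1 x2 c : Bool, c ≠ xor x1 x2 →
          P ![c, x1, x2] < P ![xor x1 x2, x1, x2] := by
  refine ⟨xorStaging, xorStaging_numStages, fun x => (xorWeight x : ℝ) / 16, ⟨⟨?_, ?_⟩, ?_⟩, ?_⟩
  · intro x
    have : (0 : ℝ) < xorWeight x := by exact_mod_cast xorWeight_pos x
    positivity
  · rw [← Finset.sum_div, ← Nat.cast_sum, xorTotal]
    norm_num
  · intro i x x' h a
    unfold condProb
    simp only [← Finset.sum_div, ← Nat.cast_sum]
    rw [xorNum i x x' h a, xorDen i x x' h]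
  · intro x1 x2 c h
    have : (xorWeight ![c, x1, x2] : ℝ) < xorWeight ![xor x1 x2, x1, x2] := by
      exact_mod_cast xorWeight_lt x1 x2 c h
    exact div_lt_div_of_pos_right this (by norm_num)
end
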